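/- The graph A1 contains the wheel W_9 as an induced subgraph (obtained by deleting the vertex (0,1)); consequently A1 is not 3-colourable and is not word-representable. -/

import Mathlib

/-- Two distinct letters `x` and `y` alternate in the word `w` if, after deleting all
letters other than `x` and `y` from `w`, no two consecutive letters of the resulting
word are equal (i.e. it reads `xyxy...` or `yxyx...`). -/
def Alternates {V : Type*} [DecidableEq V] (w : List V) (x y : V) : Prop :=
  List.Chain' (· ≠ ·) (w.filter fun z => z = x ∨ z = y)

/-- A finite simple graph `G = (V, E)` is word-representable if there is a word over the
alphabet `V` in which every element of `V` occurs at least once and such that, for all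
distinct `x, y ∈ V`, the letters `x` and `y` alternate in the word iff `{x, y} ∈ E`. -/
def WordRepresentable {V : Type*} [DecidableEq V] (G : SimpleGraph V) : Prop :=
  ∃ w : List V, (∀ v : V, v ∈ w) ∧
    ∀ x y : V, x ≠ y → (G.Adj x y ↔ Alternates w x y)

/-- The wheel graph `W_n` on `n + 1` vertices: a cycle on the `n` vertices `Sum.inl i`
(`i : Fin n`), together with one new hub vertex `Sum.inr ()` adjacent to all of them. -/
def wheelGraph (n : ℕ) : SimpleGraph (Fin n ⊕ Unit) :=
  SimpleGraph.fromRel fun a b =>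
    match a, b with
    | Sum.inl i, Sum.inl j => ((i : ℕ) + 1) % n = (j : ℕ)
    | Sum.inl _, Sum.inr _ => True
    | _, _ => False

/-- The simple graph on `V` whose edges are (the unordered versions of) the pairs
occurring in the list `l`. -/
def graphOfList {V : Type*} (l : List (V × V)) : SimpleGraph V :=
  SimpleGraph.fromRel fun a b => (a, b) ∈ l

def edgesA1 : List ((Fin 4 × Fin 3) × (Fin 4 × Fin 3)) :=
  [
    ((0, 0), (1, 0)), ((0, 0), (0, 1)), ((0, 1), (1, 1)), ((1, 0), (2, 0)), ((1, 1), (2, 1)),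
    ((1, 1), (1, 2)), ((1, 2), (2, 2)), ((2, 0), (3, 0)), ((2, 0), (2, 1)), ((2, 1), (3, 1)),
    ((2, 1), (2, 2)), ((2, 2), (3, 2)), ((3, 0), (3, 1)), ((3, 1), (3, 2)), ((2, 1), (3, 0)),
    ((0, 0), (2, 1)), ((0, 0), (1, 1)), ((1, 0), (2, 1)), ((2, 1), (3, 2)), ((1, 2), (2, 1))]

/-- The graph `A1` from the paper, with vertex set
`{(x,y) : 0 ≤ x ≤ 3, 0 ≤ y ≤ 2} \ {(0, 2)}`. -/
def graphA1 : SimpleGraph {p : Fin 4 × Fin 3 | p ≠ (0, 2)} :=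
  (graphOfList edgesA1).induce {p : Fin 4 × Fin 3 | p ≠ (0, 2)}

def wrF {V : Type*} [DecidableEq V] (w : List V) (x y : V) : Prop :=
  ∀ p, p <+: w → p.count y ≤ p.count x ∧ p.count x ≤ p.count y + 1

theorem wrF_cons {V : Type*} [DecidableEq V] (a : V) (w : List V) (x y : V) :
    wrF (a :: w) x y ↔ ∀ p, p <+: w →
      (a :: p).count y ≤ (a :: p).count x ∧ (a :: p).count x ≤ (a :: p).count y + 1 := by
  constructor
  · intro h p hp
    exact h (a :: p) (by simpa using hp)
  · intro h p hp
    rcases List.prefix_cons_iff.1 hp with rfl | ⟨t, rfl, ht⟩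
    · simp
    · exact h t ht

theorem wrF_chain {V : Type*} [DecidableEq V] (w : List V) : ∀ (x y : V), x ≠ y →
    (wrF w x y ↔ List.IsChain (· ≠ ·) (y :: w.filter fun z => z = x ∨ z = y)) := by
  induction w with
  | nil =>
    intro x y _
    simp [wrF]
  | cons a w ih =>
    intro x y hxy
    rw [wrF_cons]
    by_cases hx : a = x
    · subst hx
      have h := ih y a hxy.symm
      have e : (w.filter fun z => z = y ∨ z = a) = (w.filter fun z => z = a ∨ z = y) := by
        congr 1; funext z; simp [or_comm]
      rw [e] at h
      simp only [List.filter_cons, true_or, decide_true, if_true, List.isChain_cons_cons]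
      rw [← h]
      simp only [ne_eq, hxy.symm, not_false_eq_true, true_and]
      unfold wrF
      refine forall_congr' fun p => imp_congr_right fun _ => ?_
      simp only [List.count_cons_self, List.count_cons_of_ne hxy]
      omega
    · by_cases hy : a = y
      · subst hy
        simp only [List.filter_cons, or_true, decide_true, if_true, List.isChain_cons_cons]
        constructor
        · intro h
          have := h [] (by simp)
          simp [hxy] at this
        · intro h
          exact absurd rfl h.1
      · have := ih x y hxy
        simp only [List.filter_cons, hx, hy, or_self, decide_false]
        simp only [List.count_cons_of_ne hx, List.count_cons_of_ne hy]
        exact this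

theorem alt_iff {V : Type*} [DecidableEq V] (w : List V) (x y : V) (hxy : x ≠ y) :
    Alternates w x y ↔ wrF w x y ∨ wrF w y x := by
  rw [wrF_chain w x y hxy, wrF_chain w y x hxy.symm]
  have e : (w.filter fun z => z = y ∨ z = x) = (w.filter fun z => z = x ∨ z = y) := by
    congr 1; funext z; simp [or_comm]
  rw [e]
  have hm : ∀ z ∈ (w.filter fun z => z = x ∨ z = y), z = x ∨ z = y := by
    intro z hz; simpa using (List.mem_filter.1 hz).2
  change List.IsChain _ _ ↔ _
  generalize (w.filter fun z => z = x ∨ z = y) = L at hm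
  cases L with
  | nil => simp
  | cons a L =>
    simp only [List.isChain_cons_cons]
    rcases hm a (by simp) with rfl | rfl
    · simp [hxy.symm]
    · simp [hxy]

/-- A word in which `h` alternates with every letter satisfying `S` gives a semi-transitive
relation on these letters. -/
theorem hub_rel {V : Type*} [DecidableEq V] (w : List V) (h : V) (S : V → Prop)
    (hS : ∀ x, S x → x ≠ h ∧ Alternates w x h) :
    ∃ R : V → V → Prop, (∀ x y z, R x y → R y z → R x z) ∧
      ∀ x y, S x → S y → x ≠ y → (Alternates w x y ↔ R x y ∨ R y x) := by
  classical
  have hs : ∀ x, ∃ s : ℕ, S x → s ≤ 1 ∧ ∀ p, p <+: w →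
      p.count x ≤ p.count h + s ∧ p.count h + s ≤ p.count x + 1 := by
    intro x
    by_cases hx : S x
    · obtain ⟨hne, ha⟩ := hS x hx
      rcases (alt_iff w x h hne).1 ha with ha | ha
      · refine ⟨1, fun _ => ⟨le_rfl, fun p hp => ?_⟩⟩
        have := ha p hp
        omega
      · refine ⟨0, fun _ => ⟨by omega, fun p hp => ?_⟩⟩
        have := ha p hp
        omega
    · exact ⟨0, fun h => absurd h hx⟩
  choose s hs using hs
  refine ⟨fun x y => ∀ p, p <+: w → p.count y + s x ≤ p.count x + s y, ?_, ?_⟩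
  · intro x y z h1 h2 p hp
    have := h1 p hp
    have := h2 p hp
    omega
  · intro x y hx hy hxy
    obtain ⟨sx, hx⟩ := hs x hx
    obtain ⟨sy, hy⟩ := hs y hy
    rw [alt_iff w x y hxy]
    have hnil : ([] : List V) <+: w := by simp
    constructor
    · intro hh
      rcases Nat.lt_trichotomy (s x) (s y) with hl | hl | hl
      · left
        intro p hp
        have := hx p hp
        have := hy p hp
        rcases hh with hh | hh <;> have := hh p hp <;> omega
      · rcases hh with hh | hh
        · left; intro p hp; have := hh p hp; omega
        · right; intro p hp; have := hh p hp; omega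
      · right
        intro p hp
        have := hx p hp
        have := hy p hp
        rcases hh with hh | hh <;> have := hh p hp <;> omega
    · intro hh
      rcases Nat.lt_trichotomy (s x) (s y) with hl | hl | hl
      · right
        intro p hp
        have := hx p hp
        have := hy p hp
        rcases hh with hh | hh
        · have := hh p hp; omega
        · have := hh [] hnil; simp at this; omega
      · rcases hh with hh | hh
        · left; intro p hp; have := hh p hp; have := hx p hp; have := hy p hp; omega
        · right; intro p hp; have := hh p hp; have := hx p hp; have := hy p hp; omega
      · left
        intro p hp
        have := hx p hp
        have := hy p hp
        rcases hh with hh | hh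
        · have := hh [] hnil; simp at this; omega
        · have := hh p hp; omega

def wfun : Fin 9 ⊕ Unit → {p : Fin 4 × Fin 3 | p ≠ (0, 2)}
  | Sum.inl i => (![⟨(0,0), by decide⟩, ⟨(1,0), by decide⟩, ⟨(2,0), by decide⟩, ⟨(3,0), by decide⟩,
      ⟨(3,1), by decide⟩, ⟨(3,2), by decide⟩, ⟨(2,2), by decide⟩, ⟨(1,2), by decide⟩,
      ⟨(1,1), by decide⟩] : Fin 9 → {p : Fin 4 × Fin 3 | p ≠ (0, 2)}) i
  | Sum.inr _ => ⟨(2,1), by decide⟩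

theorem wfun_inj : Function.Injective wfun := by
  have : ∀ a b, (wfun a).1 = (wfun b).1 → a = b := by decide
  intro a b h
  exact this a b (by rw [h])

theorem wfun_hub (i : Fin 9) : graphA1.Adj (wfun (Sum.inl i)) (wfun (Sum.inr ())) := by
  revert i
  simp only [graphA1, graphOfList, SimpleGraph.comap_adj, SimpleGraph.induce,
    SimpleGraph.fromRel_adj, Function.Embedding.subtype_apply]
  decide

theorem wfun_rim (i j : Fin 9) : graphA1.Adj (wfun (Sum.inl i)) (wfun (Sum.inl j)) ↔
    (i ≠ j ∧ (((i : ℕ) + 1) % 9 = (j : ℕ) ∨ ((j : ℕ) + 1) % 9 = (i : ℕ))) := by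
  revert i j
  simp only [graphA1, graphOfList, SimpleGraph.comap_adj, SimpleGraph.induce,
    SimpleGraph.fromRel_adj, Function.Embedding.subtype_apply]
  decide

theorem wfun_range (v : {p : Fin 4 × Fin 3 | p ≠ (0, 2)}) :
    v ∈ Set.range wfun ↔ (v : Fin 4 × Fin 3) ≠ (0, 1) := by
  have : ∀ p : Fin 4 × Fin 3, p ≠ (0,2) → ((∃ a, (wfun a).1 = p) ↔ p ≠ (0,1)) := by decide
  rw [← this v.1 v.2]
  simp only [Set.mem_range, Subtype.ext_iff]

theorem wfun_adj (a b : Fin 9 ⊕ Unit) :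
    graphA1.Adj (wfun a) (wfun b) ↔ (wheelGraph 9).Adj a b := by
  rcases a with i | u <;> rcases b with j | u'
  · rw [wfun_rim]
    simp [wheelGraph]
  · simpa [wheelGraph] using wfun_hub i
  · simpa [wheelGraph] using (wfun_hub j).symm
  · simp

theorem graphA1_wheel9_not_colorable_not_wordRepresentable :
    (∃ f : wheelGraph 9 ↪g graphA1,
        ∀ v : {p : Fin 4 × Fin 3 | p ≠ (0, 2)},
          v ∈ Set.range ⇑f ↔ (v : Fin 4 × Fin 3) ≠ (0, 1)) ∧
      ¬ graphA1.Colorable 3 ∧ ¬ WordRepresentable graphA1 := by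
  refine ⟨⟨⟨⟨wfun, wfun_inj⟩, fun {a b} => wfun_adj a b⟩, wfun_range⟩, ?_, ?_⟩
  · rintro ⟨C⟩
    have key : ∀ h a b c : Fin 3, a ≠ h → b ≠ h → c ≠ h → a ≠ b → b ≠ c → a = c := by
      intro h a b c; omega
    have hub := fun i => C.valid (wfun_hub i)
    have rim : ∀ i j : Fin 9, (i ≠ j ∧ (((i : ℕ) + 1) % 9 = (j : ℕ) ∨ ((j : ℕ) + 1) % 9 = (i : ℕ))) →
      C (wfun (Sum.inl i)) ≠ C (wfun (Sum.inl j)) := fun i j h => C.valid ((wfun_rim i j).2 h)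
    have st := fun i j k h1 h2 => key _ _ _ _ (hub i) (hub j) (hub k) (rim i j h1) (rim j k h2)
    have e1 := st 0 1 2 (by decide) (by decide)
    have e2 := st 2 3 4 (by decide) (by decide)
    have e3 := st 4 5 6 (by decide) (by decide)
    have e4 := st 6 7 8 (by decide) (by decide)
    exact rim 0 8 (by decide) (e1.trans (e2.trans (e3.trans e4)))
  · rintro ⟨w, -, hw⟩
    obtain ⟨R, hR, hA⟩ := hub_rel w (wfun (Sum.inr ())) (fun v => ∃ i, v = wfun (Sum.inl i)) (by
      rintro _ ⟨i, rfl⟩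
      have hne : wfun (Sum.inl i) ≠ wfun (Sum.inr ()) := (wfun_hub i).ne
      exact ⟨hne, (hw _ _ hne).1 (wfun_hub i)⟩)
    let Q : Fin 9 → Fin 9 → Prop := fun i j => R (wfun (Sum.inl i)) (wfun (Sum.inl j))
    have hQ : ∀ i j, i ≠ j → ((Q i j ∨ Q j i) ↔
        (i ≠ j ∧ (((i : ℕ) + 1) % 9 = (j : ℕ) ∨ ((j : ℕ) + 1) % 9 = (i : ℕ)))) := by
      intro i j hij
      have hne : wfun (Sum.inl i) ≠ wfun (Sum.inl j) := fun h => hij (by simpa using wfun_inj h)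
      rw [← wfun_rim, hw _ _ hne, hA _ _ ⟨i, rfl⟩ ⟨j, rfl⟩ hne]
    have e : ∀ i : Fin 9, Q i (i+1) ∨ Q (i+1) i := fun i =>
      (hQ i (i+1) (by revert i; decide)).2 (by revert i; decide)
    have n : ∀ i : Fin 9, ¬ (Q i (i+2) ∨ Q (i+2) i) := fun i h =>
      absurd ((hQ i (i+2) (by clear h; revert i; decide)).1 h) (by clear h; revert i; decide)
    have f1 : ∀ i : Fin 9, Q i (i+1) → Q (i+2) (i+1) := by
      intro i h
      have h2 := e (i+1)
      rw [add_assoc] at h2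
      exact h2.resolve_left fun h3 => n i (Or.inl (hR _ _ _ h h3))
    have f2 : ∀ i : Fin 9, Q (i+1) i → Q (i+1) (i+2) := by
      intro i h
      have h2 := e (i+1)
      rw [add_assoc] at h2
      exact h2.resolve_right fun h3 => n i (Or.inr (hR _ _ _ h3 h))
    have g : ∀ i : Fin 9, Q i (i+1) → Q (i+2) (i+2+1) := by
      intro i h
      have := f2 (i+1) (by rw [add_assoc]; exact f1 i h)
      rw [add_assoc] at this ⊢
      rwa [add_assoc] at this
    have all : ∀ i : Fin 9, Q i (i+1) → False := by
      intro i h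
      have h5 := g _ (g _ (g _ (g _ (g _ h))))
      have e5 : i + 2 + 2 + 2 + 2 + 2 = i + 1 := by clear h h5; revert i; decide
      rw [e5, add_assoc] at h5
      exact n i (Or.inl (hR _ _ _ h h5))
    rcases e 0 with h | h
    · exact all 0 h
    · exact all _ (f2 0 h)
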